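/- Let A, B, C, D ∈ ℝ³ and a, b, c ∈ ℝ satisfy D = a·C + b·B + c·A. Then (C×D)×(A×B) = det(A,B,C)·(b·B + c·A) = det(A,B,C)·(D − a·C). -/

import Mathlib

open Matrix

/-- `det(u,v,w)`: determinant of the 3×3 matrix with columns `u, v, w`. -/
def det3 (u v w : Fin 3 → ℝ) : ℝ :=
  (Matrix.of fun i j => ![u, v, w] j i).det

/-- if `D = a·C + b·B + c·A` then
`(C×D)×(A×B) = det(A,B,C)·(b·B + c·A) = det(A,B,C)·(D − a·C)`. -/
theorem cross_cross_eq' (A B C D : Fin 3 → ℝ) (a b c : ℝ)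
    (hD : D = a • C + b • B + c • A) :
    crossProduct (crossProduct C D) (crossProduct A B)
        = det3 A B C • (b • B + c • A) ∧
    crossProduct (crossProduct C D) (crossProduct A B)
        = det3 A B C • (D - a • C) := by
  have h : crossProduct (crossProduct C D) (crossProduct A B)
      = det3 A B C • (b • B + c • A) := by
    subst hD
    ext i
    fin_cases i <;>
      simp [cross_apply, det3, Matrix.det_fin_three] <;> ring
  refine ⟨h, ?_⟩
  rw [h]
  congr 1
  rw [hD]
  abel
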